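/- arXiv:2512.11007 — 6 statements merged into one kernel-verified Lean document; each statement's English description precedes it below -/
import Mathlib

section
/- Every synchronizing DS-automaton admits a uniform winning strategy: if a DFA with finite state set Q and finite alphabet Σ is synchronizing and its transition monoid lies in the pseudovariety DS, then there exists a word a₁a₂⋯aₙ over Σ such that for every choice of letters b₁,…,bₙ ∈ Σ the interleaved word a₁b₁a₂b₂⋯aₙbₙ is a reset word. -/
open MulOpposite

variable {Q σ : Type*}

/-- The action of a word on a state: `q·w`. -/
def run (step : Q → σ → Q) (q : Q) (w : List σ) : Q := w.foldl step q

/-- A reset word. -/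
def IsReset (step : Q → σ → Q) (w : List σ) : Prop :=
  ∀ p q : Q, run step p w = run step q w

/-- The interleaving `a₁b₁a₂b₂⋯` of two words. -/
def interleave {α : Type*} (as bs : List α) : List α :=
  (as.zip bs).flatMap fun p => [p.1, p.2]

/-- The self-map of `Q` induced by the word `w`. -/
def tau (step : Q → σ → Q) (w : List σ) : Function.End Q := fun q => run step q w

/-- The transition monoid: self-maps of `Q` induced by words, with composition
written left to right (realized via the opposite of `Function.End Q`). -/
def transMonoid (step : Q → σ → Q) : Submonoid (Function.End Q)ᵐᵒᵖ where
  carrier := {f | ∃ w : List σ, f = op (tau step w)}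
  one_mem' := ⟨[], rfl⟩
  mul_mem' := by
    rintro f g ⟨u, rfl⟩ ⟨v, rfl⟩
    refine ⟨u ++ v, ?_⟩
    rw [← op_mul]
    congr 1
    funext q
    show tau step v (tau step u q) = tau step (u ++ v) q
    simp [tau, run, List.foldl_append]

/-- Green's relation ℛ. -/
def GreenR {M : Type*} [Monoid M] (x y : M) : Prop :=
  x = y ∨ ∃ s t : M, x = y * s ∧ y = x * t

/-- Green's relation ℒ. -/
def GreenL {M : Type*} [Monoid M] (x y : M) : Prop :=
  x = y ∨ ∃ s t : M, x = s * y ∧ y = t * x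

/-- Green's relation 𝒟. -/
def GreenD {M : Type*} [Monoid M] (x y : M) : Prop :=
  ∃ c : M, GreenR x c ∧ GreenL c y

/-- A regular element of a monoid. -/
def IsRegularElem {M : Type*} [Monoid M] (x : M) : Prop :=
  ∃ s : M, x * s * x = x

/-- A monoid lies in the pseudovariety `DS` if each of its regular 𝒟-classes is
closed under multiplication. -/
def MonoidInDS (M : Type*) [Monoid M] : Prop :=
  ∀ a b c : M, IsRegularElem a → GreenD a b → GreenD a c → GreenD a (b * c)

theorem key_DS {M : Type*} [Monoid M] (h : MonoidInDS M) (e : M) (he : e * e = e) (x y : M)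
    (hx : ∃ p q, e = p * x * q) (hy : ∃ p q, e = p * y * q) :
    ∃ p q, e = p * (x * y) * q := by
  obtain ⟨p, q, hp⟩ := hx
  obtain ⟨r, s, hr⟩ := hy
  have hreg : IsRegularElem e := ⟨1, by simp [he]⟩
  have h1 : GreenD e (q * e * p * x) := by
    refine ⟨e * p * x, Or.inr ⟨q, p * x, ?_, ?_⟩, Or.inr ⟨p * x, q, ?_, ?_⟩⟩
    · calc e = e * e := he.symm
        _ = e * (p * x * q) := by rw [← hp]
        _ = _ := by simp only [mul_assoc]
    · simp only [mul_assoc]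
    · calc e * p * x = (e * e) * p * x := by rw [he]
        _ = ((p * x * q) * e) * p * x := by rw [← hp]
        _ = _ := by simp only [mul_assoc]
    · simp only [mul_assoc]
  have h2 : GreenD e (y * s * e * r) := by
    refine ⟨e * r, Or.inr ⟨y * s, r, ?_, rfl⟩, Or.inr ⟨r, y * s, ?_, ?_⟩⟩
    · calc e = e * e := he.symm
        _ = e * (r * y * s) := by rw [← hr]
        _ = _ := by simp only [mul_assoc]
    · calc e * r = (e * e) * r := by rw [he]
        _ = ((r * y * s) * e) * r := by rw [← hr]
        _ = _ := by simp only [mul_assoc]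
    · simp only [mul_assoc]
  obtain ⟨c, hc1, hc2⟩ := h e _ _ hreg h1 h2
  have hc1' : ∃ t, e = c * t := by
    rcases hc1 with h | ⟨t, _, h, _⟩
    · exact ⟨1, by simp [h]⟩
    · exact ⟨t, h⟩
  have hc2' : ∃ t, c = t * (q * e * p * x * (y * s * e * r)) := by
    rcases hc2 with h | ⟨t, _, h, _⟩
    · exact ⟨1, by simp [h]⟩
    · exact ⟨t, h⟩
  obtain ⟨t, ht⟩ := hc1'
  obtain ⟨t', ht'⟩ := hc2'
  refine ⟨t' * (q * e * p), s * e * r * t, ?_⟩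
  calc e = c * t := ht
    _ = t' * (q * e * p * x * (y * s * e * r)) * t := by rw [ht']
    _ = _ := by simp only [mul_assoc]

theorem exists_idem_pow {M : Type*} [Monoid M] [Finite M] (y : M) :
    ∃ k : ℕ, y ^ (k+1) * y ^ (k+1) = y ^ (k+1) := by
  obtain ⟨i, j, hij, h⟩ : ∃ i j : ℕ, i < j ∧ y ^ i = y ^ j := by
    obtain ⟨a, b, hab, h⟩ := Finite.exists_ne_map_eq_of_infinite (fun n : ℕ => y ^ n)
    rcases lt_or_gt_of_ne hab with h' | h'
    · exact ⟨a, b, h', h⟩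
    · exact ⟨b, a, h', h.symm⟩
  obtain ⟨d, rfl⟩ := Nat.exists_eq_add_of_lt hij
  have h1 : ∀ m n, i ≤ m → y ^ (m + n * (d+1)) = y ^ m := by
    intro m n hm
    induction n with
    | zero => simp
    | succ n ih =>
      obtain ⟨c, rfl⟩ := Nat.exists_eq_add_of_le hm
      rw [← ih, show i + c + (n+1)*(d+1) = (i + d + 1) + (c + n*(d+1)) by ring, pow_add, ← h,
        ← pow_add]
      congr 1; ring
  refine ⟨(i+1) * (d+1) - 1, ?_⟩
  have : (i+1) * (d+1) - 1 + 1 = (i+1)*(d+1) := Nat.sub_add_cancel (Nat.mul_pos (by omega) (by omega))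
  rw [this, ← pow_add]
  exact h1 _ _ (by nlinarith)

theorem interleave_append {α : Type*} (a a' b b' : List α) (h : a.length = b.length) :
    interleave (a ++ a') (b ++ b') = interleave a b ++ interleave a' b' := by
  simp [interleave, List.zip_append h]

theorem mem_interleave {α : Type*} (x : α) : ∀ (a b : List α), a.length = b.length → x ∈ a →
    x ∈ interleave a b
  | [], _, _, h => by simp at h
  | c :: a, [], h, _ => by simp at h
  | c :: a, d :: b, h, hx => by
    have ih := mem_interleave x a b (by simpa using h)
    simp only [interleave, List.zip_cons_cons, List.flatMap_cons, List.mem_append] at ih ⊢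
    rcases List.mem_cons.1 hx with rfl | hx
    · left; simp
    · right; exact ih hx

/-- the element of the transition monoid given by a word -/
def TM {Q σ : Type*} (step : Q → σ → Q) (w : List σ) : ↥(transMonoid step) :=
  ⟨op (tau step w), ⟨w, rfl⟩⟩

theorem TM_append {Q σ : Type*} (step : Q → σ → Q) (u v : List σ) :
    TM step (u ++ v) = TM step u * TM step v := by
  apply Subtype.ext
  show op (tau step (u ++ v)) = op (tau step u) * op (tau step v)
  rw [← op_mul]
  congr 1
  funext q
  show tau step (u ++ v) q = tau step v (tau step u q)
  simp [tau, run, List.foldl_append]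

/-- constant elements -/
def CM {Q σ : Type*} (step : Q → σ → Q) (m : ↥(transMonoid step)) : Prop :=
  ∀ p q : Q, m.1.unop p = m.1.unop q

theorem CM_mul {Q σ : Type*} (step : Q → σ → Q) (a m b : ↥(transMonoid step))
    (h : CM step m) : CM step (a * m * b) := by
  intro p q
  show b.1.unop (m.1.unop (a.1.unop p)) = b.1.unop (m.1.unop (a.1.unop q))
  rw [h]

/-- Every synchronizing DS-automaton admits a uniform winning
strategy. -/
theorem synchronizing_DS_automaton_has_uniform_winning_strategy
    {Q σ : Type*} [Finite Q] [Nonempty Q] [Finite σ]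
    (step : Q → σ → Q)
    (hsync : ∃ w : List σ, IsReset step w)
    (hDS : MonoidInDS ↥(transMonoid step)) :
    ∃ as : List σ, ∀ bs : List σ, bs.length = as.length →
      IsReset step (interleave as bs) := by
  classical
  obtain ⟨w, hw⟩ := hsync
  have : Finite (Function.End Q) := inferInstanceAs (Finite (Q → Q))
  have : Finite (Function.End Q)ᵐᵒᵖ := Finite.of_equiv _ opEquiv
  have : Finite ↥(transMonoid step) := inferInstance
  have := Fintype.ofFinite σ
  have := Fintype.ofFinite ↥(transMonoid step)
  let L : List σ := Finset.univ.toList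
  have hL : ∀ x, x ∈ L := fun x => by simp [L]
  let N := Fintype.card ↥(transMonoid step)
  let A : ℕ → List σ := fun i => (List.replicate i L).flatten
  have hA : ∀ i j, A (i + j) = A i ++ A j := fun i j => by
    simp only [A, ← List.flatten_append, List.replicate_append_replicate]
  have hAl : ∀ i, (A i).length = i * L.length := fun i => by simp [A]
  refine ⟨A N, fun bs hbs => ?_⟩
  rw [hAl] at hbs
  let P : ℕ → List σ := fun i => interleave (A i) (bs.take (i * L.length))
  have hP : ∀ i d, i + d ≤ N →
      P (i + d) = P i ++ interleave (A d) ((bs.drop (i * L.length)).take (d * L.length)) := by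
    intro i d hid
    simp only [P]
    rw [hA, add_mul, List.take_add, interleave_append]
    rw [hAl, List.length_take, hbs, min_eq_left]
    exact Nat.mul_le_mul_right _ (by omega)
  obtain ⟨i, d, hid, hT⟩ : ∃ i d, i + (d + 1) ≤ N ∧ TM step (P i) = TM step (P (i + (d + 1))) := by
    obtain ⟨a, b, hab, h⟩ := Fintype.exists_ne_map_eq_of_card_lt
      (fun n : Fin (N + 1) => TM step (P n)) (by simp [N])
    have hab' : (a : ℕ) ≠ b := fun h => hab (Fin.ext h)
    have ha := a.2
    have hb := b.2
    rcases lt_or_gt_of_ne hab' with h' | h'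
    · refine ⟨a, b - a - 1, by omega, ?_⟩
      rw [show (a : ℕ) + (b - a - 1 + 1) = b by omega]; exact h
    · refine ⟨b, a - b - 1, by omega, ?_⟩
      rw [show (b : ℕ) + (a - b - 1 + 1) = a by omega]; exact h.symm
  rw [hP i _ hid, TM_append] at hT
  set Y := interleave (A (d + 1)) ((bs.drop (i * L.length)).take ((d + 1) * L.length)) with hY
  have hYmem : ∀ x, x ∈ Y := by
    intro x
    apply mem_interleave
    · rw [hAl, List.length_take, List.length_drop, hbs, ← Nat.sub_mul, min_eq_left]
      exact Nat.mul_le_mul_right _ (by omega)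
    · rw [hA]; simp [A, hL]
  obtain ⟨k, hk⟩ := exists_idem_pow (TM step Y)
  have hTk : ∀ n, TM step (P i) = TM step (P i) * (TM step Y) ^ n := by
    intro n
    induction n with
    | zero => simp
    | succ n ih => rw [pow_succ, ← mul_assoc, ← ih]; exact hT
  set e := TM step Y ^ (k + 1) with he
  have hlet : ∀ x : σ, ∃ p q, e = p * TM step [x] * q := by
    intro x
    obtain ⟨s, t, hst⟩ := List.append_of_mem (hYmem x)
    refine ⟨TM step Y ^ k * TM step s, TM step t, ?_⟩
    have : TM step Y = TM step s * (TM step [x] * TM step t) := by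
      rw [← TM_append, ← TM_append, hst]; rfl
    rw [he, pow_succ]
    conv_lhs => rw [show TM step Y ^ k * TM step Y = TM step Y ^ k * (TM step s * (TM step [x] * TM step t)) by rw [← this]]
    simp only [mul_assoc]
  have hword : ∀ v : List σ, ∃ p q, e = p * TM step v * q := by
    intro v
    induction v with
    | nil => exact ⟨1, e, by rw [show TM step [] = 1 from rfl]; simp⟩
    | cons x v ih =>
      rw [show x :: v = [x] ++ v from rfl, TM_append]
      exact key_DS hDS e hk _ _ (hlet x) ih
  obtain ⟨p, q, hpq⟩ := hword w
  have hCe : CM step e := by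
    rw [hpq]; exact CM_mul step _ _ _ hw
  have hfin : CM step (TM step (P N)) := by
    have h1 := hP i (N - i) (by omega)
    rw [show i + (N - i) = N by omega] at h1
    rw [h1, TM_append, hTk (k + 1)]
    exact CM_mul step _ _ _ hCe
  have hPN : P N = interleave (A N) bs := by
    simp only [P]; rw [← hbs, List.take_length]
  rw [hPN] at hfin
  exact hfin
end

section
/- The uniform winning strategy for DS-automata is robust under the modified game rule in which Bob may respond with an arbitrary (possibly empty) word: if a DFA with finite state set Q and finite alphabet Σ is synchronizing and its transition monoid lies in the pseudovariety DS, then there exists a word a₁a₂⋯aₙ over Σ such that for every choice of words u₁,…,uₙ over Σ (each possibly empty), the word a₁u₁a₂u₂⋯aₙuₙ is a reset word. -/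
open MulOpposite

variable {Q σ : Type*}

/-- `e` lies in the two-sided ideal generated by `x`. -/
def BelowJ {M : Type*} [Monoid M] (e x : M) : Prop := ∃ a b : M, a * x * b = e

theorem BelowJ.mul_of_DS {M : Type*} [Monoid M] (hM : MonoidInDS M) {e x y : M}
    (he : e * e = e) (hx : BelowJ e x) (hy : BelowJ e y) : BelowJ e (x * y) := by
  obtain ⟨a, b, hab⟩ := hx
  obtain ⟨c, d, hcd⟩ := hy
  have h1 : GreenD e (b * e * a * x) := by
    refine ⟨e * a * x, Or.inr ⟨b * e, a * x, ?_, ?_⟩, Or.inr ⟨e * a * x, b, ?_, ?_⟩⟩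
    · calc e = e * (a * x * b) * e := by rw [hab, he, he]
        _ = _ := by simp only [mul_assoc]
    · simp only [mul_assoc]
    · calc e * a * x = e * (a * x * b) * e * a * x := by rw [hab, he, he]
        _ = _ := by simp only [mul_assoc]
    · simp only [mul_assoc]
  have h2 : GreenD e (y * d * e * c) := by
    refine ⟨e * c, Or.inr ⟨y * d * e, c, ?_, rfl⟩, Or.inr ⟨e * c, y * d, ?_, ?_⟩⟩
    · calc e = e * (c * y * d) * e := by rw [hcd, he, he]
        _ = _ := by simp only [mul_assoc]
    · calc e * c = e * (c * y * d) * e * c := by rw [hcd, he, he]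
        _ = _ := by simp only [mul_assoc]
    · simp only [mul_assoc]
  obtain ⟨r, hr, hl⟩ := hM e _ _ ⟨e, by rw [he, he]⟩ h1 h2
  have hr' : ∃ s, e = r * s := by
    rcases hr with rfl | ⟨s, t, h, -⟩
    · exact ⟨1, by simp⟩
    · exact ⟨s, h⟩
  have hl' : ∃ s, r = s * (b * e * a * x * (y * d * e * c)) := by
    rcases hl with h | ⟨s, t, h, -⟩
    · exact ⟨1, by rw [one_mul]; exact h⟩
    · exact ⟨s, h⟩
  obtain ⟨s, hs⟩ := hr'
  obtain ⟨t, ht⟩ := hl'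
  refine ⟨t * (b * e * a), d * e * c * s, ?_⟩
  conv_rhs => rw [hs, ht]
  simp only [mul_assoc]

theorem exists_pow_idem {M : Type*} [Monoid M] [Finite M] (t : M) :
    ∃ n : ℕ, t ^ (n + 1) * t ^ (n + 1) = t ^ (n + 1) := by
  obtain ⟨i, j, hij, h⟩ := Finite.exists_ne_map_eq_of_infinite (fun n : ℕ => t ^ (n + 1))
  wlog hlt : i < j generalizing i j
  · exact this j i hij.symm h.symm (by omega)
  obtain ⟨k, rfl⟩ : ∃ k, j = i + (k + 1) := ⟨j - i - 1, by omega⟩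
  have h' : t ^ (i + 1) = t ^ (i + 1) * t ^ (k + 1) := by
    rw [← pow_add, h]; congr 1; omega
  have key : ∀ m, t ^ (i + 1) = t ^ (i + 1) * t ^ ((k + 1) * m) := by
    intro m
    induction m with
    | zero => simp
    | succ m ih => rw [mul_add, mul_one, pow_add t ((k + 1) * m), ← mul_assoc, ← ih, ← h']
  have e1 : i + 1 + ((k + 1) * (i + 1) - (i + 1)) = (k + 1) * (i + 1) := by
    have : 1 * (i + 1) ≤ (k + 1) * (i + 1) := Nat.mul_le_mul_right _ (by omega)
    omega
  have e2 : (k + 1) * (i + 1) = (k * (i + 1) + i) + 1 := by ring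
  refine ⟨k * (i + 1) + i, ?_⟩
  rw [← e2]
  generalize (k + 1) * (i + 1) - (i + 1) = r at e1
  have hk := key (i + 1)
  calc t ^ ((k + 1) * (i + 1)) * t ^ ((k + 1) * (i + 1))
      = t ^ r * (t ^ (i + 1) * t ^ ((k + 1) * (i + 1))) := by
        rw [← mul_assoc, ← pow_add t r, add_comm r, e1]
    _ = t ^ ((k + 1) * (i + 1)) := by rw [← hk, ← pow_add, add_comm r, e1]

theorem exists_blocks {σ : Type*} (w : List σ) (hw : ∀ a, a ∈ w) : ∀ (N : ℕ)
    (us : List (List σ)), us.length = ((List.replicate N w).flatten).length →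
    ∃ bs : List (List σ), bs.length = N ∧ (∀ b ∈ bs, ∀ a, a ∈ b) ∧
      ((((List.replicate N w).flatten).zip us).flatMap fun p => p.1 :: p.2) = bs.flatten := by
  intro N
  induction N with
  | zero => intro us _; exact ⟨[], by simp⟩
  | succ N ih =>
    intro us hus
    rw [List.replicate_succ, List.flatten_cons, List.length_append] at hus
    obtain ⟨bs, h1, h2, h3⟩ := ih (us.drop w.length) (by rw [List.length_drop]; omega)
    have hlen : w.length = (us.take w.length).length := by rw [List.length_take]; omega
    refine ⟨((w.zip (us.take w.length)).flatMap fun p => p.1 :: p.2) :: bs, by simp [h1], ?_, ?_⟩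
    · intro b hb a
      rcases List.mem_cons.1 hb with rfl | hb
      · have hz : (w.zip (us.take w.length)).map Prod.fst = w :=
          List.map_fst_zip hlen.le
        have ha := hw a
        rw [← hz, List.mem_map] at ha
        obtain ⟨p, hp, rfl⟩ := ha
        exact List.mem_flatMap.2 ⟨p, hp, by simp⟩
      · exact h2 b hb a
    · rw [List.replicate_succ, List.flatten_cons, List.flatten_cons, ← h3,
        ← List.flatMap_append, ← List.zip_append hlen, List.take_append_drop]

/-- The element of the transition monoid induced by a word. -/
def trEl {Q σ : Type*} (step : Q → σ → Q) (w : List σ) : transMonoid step :=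
  ⟨op (tau step w), w, rfl⟩

theorem run_append {Q σ : Type*} (step : Q → σ → Q) (q : Q) (u v : List σ) :
    run step q (u ++ v) = run step (run step q u) v := by
  simp [run, List.foldl_append]

theorem trEl_append {Q σ : Type*} (step : Q → σ → Q) (u v : List σ) :
    trEl step (u ++ v) = trEl step u * trEl step v := by
  apply Subtype.ext
  apply unop_injective
  funext q
  exact run_append step q u v

theorem trEl_surj {Q σ : Type*} (step : Q → σ → Q) (x : transMonoid step) :
    ∃ w, x = trEl step w := by
  obtain ⟨x, w, rfl⟩ := x
  exact ⟨w, rfl⟩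

theorem trEl_run {Q σ : Type*} (step : Q → σ → Q) {u v : List σ}
    (h : trEl step u = trEl step v) (q : Q) : run step q u = run step q v :=
  congrFun (congrArg (fun x : transMonoid step => unop x.1) h) q

theorem isReset_mid {Q σ : Type*} (step : Q → σ → Q) {w : List σ} (h : IsReset step w)
    (u v : List σ) : IsReset step (u ++ w ++ v) := by
  intro p q
  simp only [run_append]
  rw [h (run step p u) (run step q u)]

/-- The uniform winning strategy for synchronizing DS-automata is
robust under the modified rule where Bob may respond with arbitrary (possibly
empty) words. -/
theorem synchronizing_DS_automaton_uniform_strategy_modified_rule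
    {Q σ : Type*} [Finite Q] [Nonempty Q] [Finite σ]
    (step : Q → σ → Q)
    (hsync : ∃ w : List σ, IsReset step w)
    (hDS : MonoidInDS ↥(transMonoid step)) :
    ∃ as : List σ, ∀ us : List (List σ), us.length = as.length →
      IsReset step ((as.zip us).flatMap fun p => p.1 :: p.2) := by
  classical
  obtain ⟨r, hr⟩ := hsync
  have : Fintype σ := Fintype.ofFinite σ
  have : Finite (Function.End Q) := inferInstanceAs (Finite (Q → Q))
  have : Finite (Function.End Q)ᵐᵒᵖ := Finite.of_equiv _ opEquiv
  have hfin : Finite (transMonoid step) := inferInstance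
  let w : List σ := Finset.univ.toList
  have hw : ∀ a, a ∈ w := fun a => by simp [w]
  refine ⟨(List.replicate (Nat.card (transMonoid step)) w).flatten, fun us hus => ?_⟩
  obtain ⟨bs, h1, h2, h3⟩ := exists_blocks w hw _ us hus
  rw [h3]
  have hnotinj : ∃ i j : Fin (bs.length + 1), i ≠ j ∧
      trEl step (bs.take i).flatten = trEl step (bs.take j).flatten := by
    by_contra! hcon
    have hinj : Function.Injective
        (fun i : Fin (bs.length + 1) => trEl step (bs.take i).flatten) := by
      intro i j hij
      by_contra hne
      exact hcon i j hne hij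
    have := Nat.card_le_card_of_injective _ hinj
    rw [Nat.card_fin] at this
    omega
  obtain ⟨i, j, hne, hij⟩ := hnotinj
  wlog hlt : i < j generalizing i j
  · exact this j i hne.symm hij.symm (lt_of_le_of_ne (not_lt.1 hlt) hne.symm)
  have hlt' : (i : ℕ) < j := hlt
  have hi : (i : ℕ) < bs.length := by omega
  set T := ((bs.take j).drop i) with hT
  have hsplit : bs.take j = bs.take i ++ T := by
    rw [hT]
    conv_lhs => rw [← List.take_append_drop i (bs.take j)]
    rw [List.take_take, min_eq_left hlt'.le]
  have hbT : bs[(i : ℕ)] ∈ T := by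
    rw [hT, List.mem_iff_getElem]
    exact ⟨0, by simp; omega, by simp⟩
  have hTa : ∀ a, a ∈ T.flatten := fun a =>
    List.mem_flatten.2 ⟨_, hbT, h2 _ (List.getElem_mem hi) a⟩
  set p := trEl step (bs.take i).flatten with hp
  set t := trEl step T.flatten with ht
  have hpt : p * t = p := by
    rw [hp, ht, ← trEl_append, ← List.flatten_append, ← hsplit, ← hij]
  have hptn : ∀ n, p * t ^ n = p := by
    intro n
    induction n with
    | zero => simp
    | succ n ih => rw [pow_succ, ← mul_assoc, ih, hpt]
  obtain ⟨n, hn⟩ := exists_pow_idem t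
  have hall : ∀ v : List σ, BelowJ (t ^ (n + 1)) (trEl step v) := by
    intro v
    induction v with
    | nil =>
      refine ⟨t ^ (n + 1), 1, ?_⟩
      have : trEl step [] = 1 := rfl
      rw [this, mul_one, mul_one]
    | cons a v ih =>
      have : a :: v = [a] ++ v := rfl
      rw [this, trEl_append]
      refine BelowJ.mul_of_DS hDS hn ?_ ih
      obtain ⟨x, y, hxy⟩ := List.append_of_mem (hTa a)
      refine ⟨t ^ n * trEl step x, trEl step y, ?_⟩
      have h5 : x ++ a :: y = x ++ ([a] ++ y) := rfl
      have h6 : t = trEl step x * (trEl step [a] * trEl step y) := by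
        rw [ht, hxy, h5, trEl_append, trEl_append]
      calc t ^ n * trEl step x * trEl step [a] * trEl step y
          = t ^ n * (trEl step x * (trEl step [a] * trEl step y)) := by simp only [mul_assoc]
        _ = t ^ (n + 1) := by rw [← h6, pow_succ]
  obtain ⟨x, y, hxy⟩ := hall r
  obtain ⟨x, rfl⟩ := trEl_surj step x
  obtain ⟨y, rfl⟩ := trEl_surj step y
  have hpe := hptn (n + 1)
  rw [← hxy, ← trEl_append, ← trEl_append, hp, ← trEl_append] at hpe
  have hpre : IsReset step (bs.take i).flatten := by
    intro q q'
    rw [← trEl_run step hpe q, ← trEl_run step hpe q']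
    have := isReset_mid step hr ((bs.take i).flatten ++ x) y q q'
    simpa only [List.append_assoc] using this
  have hfull : bs.flatten = [] ++ (bs.take i).flatten ++ (bs.drop i).flatten := by
    rw [List.nil_append, ← List.flatten_append, List.take_append_drop]
  rw [hfull]
  exact isReset_mid step hpre _ _
end

section
/- If the letter actions of a DFA pairwise commute (i.e., q·(ab) = q·(ba) for all q ∈ Q and all a,b ∈ Σ, so the transition monoid is commutative) and w is a reset word for the DFA, then w is a uniform winning strategy for the DFA. -/
open MulOpposite

variable {Q σ : Type*}

/-- If the letter actions of a DFA pairwise commute, then every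
reset word is a uniform winning strategy. -/
theorem commutative_reset_word_is_uniform_winning_strategy
    {Q σ : Type*} [Finite Q] [Nonempty Q] [Finite σ]
    (step : Q → σ → Q)
    (hcomm : ∀ (q : Q) (x y : σ), run step q [x, y] = run step q [y, x])
    (w : List σ) (hw : IsReset step w) :
    ∀ bs : List σ, bs.length = w.length → IsReset step (interleave w bs) := by
  intro bs hlen p q
  have hperm : ∀ (as cs : List σ), cs.length = as.length →
      (interleave as cs).Perm (cs ++ as) := by
    intro as
    induction as with
    | nil =>
      intro cs h
      cases cs with
      | nil => simp [interleave]
      | cons c cs => simp at h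
    | cons a as ih =>
      intro cs h
      cases cs with
      | nil => simp at h
      | cons c cs =>
        have h1 : (interleave as cs).Perm (cs ++ as) := ih cs (by simpa using h)
        have h2 : interleave (a :: as) (c :: cs) = a :: c :: interleave as cs := by
          simp [interleave]
        rw [h2]
        refine (List.Perm.swap c a _).trans ?_
        rw [List.cons_append]
        refine List.Perm.cons c ?_
        exact (List.Perm.cons a h1).trans List.perm_middle.symm
  haveI : RightCommutative step := ⟨fun q x y => by simpa [run] using hcomm q x y⟩
  have key : ∀ r : Q, run step r (interleave w bs) = run step (run step r bs) w := by
    intro r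
    unfold run
    rw [(hperm w bs hlen).foldl_eq r, List.foldl_append]
  rw [key p, key q]
  exact hw _ _
end

section
/- If a DFA with n = |Q| states admits a uniform winning strategy, then it admits a uniform winning strategy of length at most 2^(2^n − 1) − 2^n. -/
open MulOpposite

variable {Q σ : Type*}

theorem uws_path {X σ : Type*} [Fintype X] (δ : X → σ → X) (P : X → Prop) [DecidablePred P]
    (x0 : X) (h : ∃ w : List σ, P (w.foldl δ x0)) :
    ∃ w : List σ, P (w.foldl δ x0) ∧ w.length ≤ (Finset.univ.filter fun x => ¬ P x).card := by
  classical
  have hex : ∃ n, ∃ w : List σ, P (w.foldl δ x0) ∧ w.length = n := by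
    obtain ⟨w, hw⟩ := h
    exact ⟨_, w, hw, rfl⟩
  obtain ⟨w, hw, hl⟩ := Nat.find_spec hex
  have hmin : ∀ v : List σ, P (v.foldl δ x0) → w.length ≤ v.length := by
    intro v hv
    rw [hl]
    exact Nat.find_min' hex ⟨v, hv, rfl⟩
  refine ⟨w, hw, ?_⟩
  have key : ∀ i j, i < j → j < w.length →
      (w.take i).foldl δ x0 ≠ (w.take j).foldl δ x0 := by
    intro i j hij hj he
    have h1 : P ((w.take i ++ w.drop j).foldl δ x0) := by
      rw [List.foldl_append, he, ← List.foldl_append, List.take_append_drop]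
      exact hw
    have := hmin _ h1
    simp only [List.length_append, List.length_take, List.length_drop] at this
    omega
  have := Finset.card_le_card_of_injOn (s := Finset.range w.length)
    (t := Finset.univ.filter fun x => ¬ P x) (fun i => (w.take i).foldl δ x0)
    (by
      intro i hi
      have hi' : i < w.length := by simpa using hi
      simp only [Finset.coe_filter, Finset.mem_univ, true_and, Set.mem_ofPred_eq]
      intro hp
      have := hmin _ hp
      simp only [List.length_take] at this
      omega)
    (by
      intro i hi j hj he
      have hi' : i < w.length := by simpa using hi
      have hj' : j < w.length := by simpa using hj
      rcases lt_trichotomy i j with hlt | heq | hgt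
      · exact absurd he (key i j hlt hj')
      · exact heq
      · exact absurd he.symm (key j i hgt hi'))
  simpa using this

open Classical in
theorem uws_card (Q : Type*) [Fintype Q] :
    ((Finset.univ : Finset (Finset {S : Finset Q // S.Nonempty})).filter
      fun F => ¬ ∀ S ∈ F, S.1.card = 1).card =
    2 ^ (2 ^ Fintype.card Q - 1) - 2 ^ Fintype.card Q := by
  have hT : Fintype.card {S : Finset Q // S.Nonempty} = 2 ^ Fintype.card Q - 1 := by
    have : (Finset.univ.filter fun S : Finset Q => S.Nonempty) = Finset.univ.erase ∅ := by
      ext S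
      simp [Finset.nonempty_iff_ne_empty]
    rw [Fintype.card_subtype, this, Finset.card_erase_of_mem (Finset.mem_univ _)]
    simp
  have hS : ((Finset.univ : Finset {S : Finset Q // S.Nonempty}).filter
      fun S => S.1.card = 1).card = Fintype.card Q := by
    have : ((Finset.univ : Finset {S : Finset Q // S.Nonempty}).filter fun S => S.1.card = 1)
        = Finset.univ.image fun q : Q => ⟨{q}, Finset.singleton_nonempty q⟩ := by
      ext S
      simp only [Finset.mem_filter, Finset.mem_univ, true_and, Finset.mem_image,
        Finset.card_eq_one, Subtype.ext_iff]
      exact exists_congr fun a => eq_comm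
    rw [this, Finset.card_image_of_injective]
    · rfl
    · intro a b hab
      simpa using hab
  have hP : ((Finset.univ : Finset (Finset {S : Finset Q // S.Nonempty})).filter
      fun F => ∀ S ∈ F, S.1.card = 1).card = 2 ^ Fintype.card Q := by
    rw [← hS, ← Finset.card_powerset]
    congr 1
    ext F
    simp [Finset.subset_iff]
  have := Finset.card_filter_add_card_filter_not
    (s := (Finset.univ : Finset (Finset {S : Finset Q // S.Nonempty})))
    (fun F => ∀ S ∈ F, S.1.card = 1)
  rw [hP, Finset.card_univ, Fintype.card_finset, hT] at this
  omega

open Classical in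
noncomputable def uwsStep {Q σ : Type*} [Fintype Q] (step : Q → σ → Q)
    (F : Finset {S : Finset Q // S.Nonempty}) (a : σ) : Finset {S : Finset Q // S.Nonempty} :=
  Finset.univ.filter fun T => ∃ S ∈ F, ∃ b : σ,
    T.1 = S.1.image fun q => step (step q a) b

open Classical in
theorem uws_mem {Q σ : Type*} [Fintype Q] (step : Q → σ → Q) (w : List σ) :
    ∀ (F : Finset {S : Finset Q // S.Nonempty}) (T : {S : Finset Q // S.Nonempty}),
    T ∈ w.foldl (uwsStep step) F ↔ ∃ S ∈ F, ∃ bs : List σ, bs.length = w.length ∧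
      T.1 = S.1.image fun q => run step q (interleave w bs) := by
  induction w with
  | nil =>
    intro F T
    constructor
    · intro h
      exact ⟨T, h, [], rfl, by simp [run, interleave]⟩
    · rintro ⟨S, hS, bs, -, he⟩
      have : T = S := Subtype.ext (by simpa [run, interleave] using he)
      simpa [this] using hS
  | cons a w ih =>
    intro F T
    rw [List.foldl_cons, ih]
    constructor
    · rintro ⟨S, hS, bs, hl, he⟩
      obtain ⟨R, hR, b, hb⟩ := (Finset.mem_filter.1 hS).2
      refine ⟨R, hR, b :: bs, by simp [hl], ?_⟩
      rw [he, hb, Finset.image_image]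
      rfl
    · rintro ⟨R, hR, bs, hl, he⟩
      cases bs with
      | nil => simp at hl
      | cons b bs =>
        refine ⟨⟨R.1.image fun q => step (step q a) b, R.2.image _⟩, ?_, bs, by simpa using hl, ?_⟩
        · exact Finset.mem_filter.2 ⟨Finset.mem_univ _, R, hR, b, rfl⟩
        · rw [he, Finset.image_image]
          rfl

/-- A DFA with `n` states admitting a uniform winning strategy
admits one of length at most `2^(2^n - 1) - 2^n`. -/
theorem uniform_winning_strategy_length_bound
    {Q σ : Type*} [Fintype Q] [Nonempty Q] [Finite σ]
    (step : Q → σ → Q)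
    (h : ∃ as : List σ, ∀ bs : List σ, bs.length = as.length →
      IsReset step (interleave as bs)) :
    ∃ as : List σ,
      (∀ bs : List σ, bs.length = as.length → IsReset step (interleave as bs)) ∧
      as.length ≤ 2 ^ (2 ^ Fintype.card Q - 1) - 2 ^ Fintype.card Q := by
  classical
  let F0 : Finset {S : Finset Q // S.Nonempty} := {⟨Finset.univ, Finset.univ_nonempty⟩}
  have hiff : ∀ as : List σ,
      (∀ bs : List σ, bs.length = as.length → IsReset step (interleave as bs)) ↔
      ∀ S ∈ as.foldl (uwsStep step) F0, S.1.card = 1 := by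
    intro as
    constructor
    · intro H S hS
      obtain ⟨R, hR, bs, hl, he⟩ := (uws_mem step as F0 S).1 hS
      apply le_antisymm _ (Finset.card_pos.2 S.2)
      rw [he, Finset.card_le_one]
      intro x hx y hy
      obtain ⟨p, -, rfl⟩ := Finset.mem_image.1 hx
      obtain ⟨q, -, rfl⟩ := Finset.mem_image.1 hy
      exact H bs hl p q
    · intro H bs hl p q
      have := H ⟨Finset.univ.image fun q => run step q (interleave as bs),
        Finset.univ_nonempty.image _⟩
        ((uws_mem step as F0 _).2 ⟨_, Finset.mem_singleton_self _, bs, hl, rfl⟩)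
      exact Finset.card_le_one.1 this.le _ (Finset.mem_image_of_mem _ (Finset.mem_univ p)) _
        (Finset.mem_image_of_mem _ (Finset.mem_univ q))
  obtain ⟨as, has⟩ := h
  obtain ⟨w, hw, hl⟩ := uws_path (uwsStep step) (fun F => ∀ S ∈ F, S.1.card = 1) F0
    ⟨as, (hiff as).1 has⟩
  refine ⟨w, (hiff w).2 hw, ?_⟩
  rw [← uws_card Q]
  convert hl
end

section
/- If a DFA with n = |Q| states admits a uniform winning strategy, then for every pair of states p,q ∈ Q there exists a word a₁⋯a_k over Σ of length k ≤ 2^(n(n+1)/2) − 2^n such that for every choice of letters b₁,…,b_k ∈ Σ, the states p·(a₁b₁⋯a_kb_k) and q·(a₁b₁⋯a_kb_k) coincide (i.e., Alice can uniformly synchronize every 2-element subset with a word of this length). -/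
open MulOpposite

variable {Q σ : Type*}

theorem aux_short {α σ : Type*} [Fintype α] [DecidableEq α] (f : α → σ → α) (P : Finset α)
    (x : α) (h : ∃ w : List σ, w.foldl f x ∈ P) :
    ∃ w : List σ, w.length ≤ (Pᶜ).card ∧ w.foldl f x ∈ P := by
  classical
  have h' : ∃ k, ∃ w : List σ, w.length = k ∧ w.foldl f x ∈ P := by
    obtain ⟨w, hw⟩ := h
    exact ⟨_, w, rfl, hw⟩
  obtain ⟨w, hk, hw⟩ := Nat.find_spec h'
  have hmin : ∀ v : List σ, v.foldl f x ∈ P → w.length ≤ v.length := by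
    intro v hv
    rw [hk]
    exact Nat.find_min' h' ⟨v, rfl, hv⟩
  refine ⟨w, ?_, hw⟩
  have key : ∀ i j, i < j → j < w.length →
      (w.take i).foldl f x ≠ (w.take j).foldl f x := by
    intro i j hij hj he
    have h1 : (w.take i ++ w.drop j).foldl f x ∈ P := by
      rw [List.foldl_append, he, ← List.foldl_append, List.take_append_drop]
      exact hw
    have := hmin _ h1
    simp at this
    omega
  have := Finset.card_le_card_of_injOn (s := Finset.range w.length) (t := Pᶜ)
    (fun i => (w.take i).foldl f x) ?_ ?_
  · simpa using this
  · intro i hi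
    simp only [Finset.coe_range, Set.mem_Iio] at hi
    simp only [Finset.coe_compl, Set.mem_compl_iff, Finset.mem_coe]
    intro hc
    have := hmin _ hc
    simp at this
    omega
  · intro i hi j hj he
    simp only [Finset.coe_range, Set.mem_Iio] at hi hj
    rcases lt_trichotomy i j with hl | hl | hl
    · exact absurd he (key i j hl hj)
    · exact hl
    · exact absurd he.symm (key j i hl hi)

open Classical in
noncomputable def auxF {Q σ : Type*} [Fintype Q] (step : Q → σ → Q)
    (S : Finset (Sym2 Q)) (a : σ) : Finset (Sym2 Q) :=
  Finset.univ.filter fun z => ∃ y ∈ S, ∃ b, z = y.map fun q => step (step q a) b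

theorem aux_mem {Q σ : Type*} [Fintype Q] (step : Q → σ → Q) (as : List σ) :
    ∀ (S : Finset (Sym2 Q)) (z : Sym2 Q), z ∈ as.foldl (auxF step) S ↔
      ∃ y ∈ S, ∃ bs : List σ, bs.length = as.length ∧
        z = y.map fun q => run step q (interleave as bs) := by
  induction as with
  | nil =>
    intro S z
    simp [interleave, run]
  | cons a as ih =>
    intro S z
    rw [List.foldl_cons, ih]
    constructor
    · rintro ⟨y, hy, bs, hl, rfl⟩
      simp only [auxF, Finset.mem_filter, Finset.mem_univ, true_and] at hy
      obtain ⟨y, hy, b, rfl⟩ := hy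
      refine ⟨y, hy, b :: bs, by simp [hl], ?_⟩
      rw [Sym2.map_map]
      rfl
    · rintro ⟨y, hy, bs, hl, rfl⟩
      cases bs with
      | nil => simp at hl
      | cons b bs =>
        refine ⟨y.map fun q => step (step q a) b, ?_, bs, by simpa using hl, ?_⟩
        · simp only [auxF, Finset.mem_filter, Finset.mem_univ, true_and]
          exact ⟨y, hy, b, rfl⟩
        · rw [Sym2.map_map]
          rfl

/-- In a DFA with `n` states admitting a uniform winning
strategy, Alice can uniformly synchronize every 2-element subset with a word of
length at most `2^(n(n+1)/2) - 2^n`. -/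
theorem uniform_pair_synchronization_length_bound
    {Q σ : Type*} [Fintype Q] [Nonempty Q] [Finite σ]
    (step : Q → σ → Q)
    (h : ∃ as : List σ, ∀ bs : List σ, bs.length = as.length →
      IsReset step (interleave as bs)) :
    ∀ p q : Q, ∃ as : List σ,
      as.length ≤ 2 ^ (Fintype.card Q * (Fintype.card Q + 1) / 2) - 2 ^ Fintype.card Q ∧
      ∀ bs : List σ, bs.length = as.length →
        run step p (interleave as bs) = run step q (interleave as bs) := by
  classical
  intro p q
  set D : Finset (Sym2 Q) := Finset.univ.image Sym2.diag with hD
  have hDc : D.card = Fintype.card Q := by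
    rw [hD, Finset.card_image_of_injective _ Sym2.diag_injective, Finset.card_univ]
  have hmD : ∀ x y : Q, s(x, y) ∈ D ↔ x = y := by
    intro x y
    rw [hD]
    simp only [Finset.mem_image, Finset.mem_univ, true_and]
    constructor
    · rintro ⟨z, hz⟩
      rw [Sym2.diag, Sym2.eq_iff] at hz
      rcases hz with ⟨h1, h2⟩ | ⟨h1, h2⟩
      · exact h1.symm.trans h2
      · exact h2.symm.trans h1
    · rintro rfl
      exact ⟨x, rfl⟩
  have hcard : ((D.powerset)ᶜ).card =
      2 ^ (Fintype.card Q * (Fintype.card Q + 1) / 2) - 2 ^ Fintype.card Q := by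
    rw [Finset.card_compl, Finset.card_powerset, hDc, Fintype.card_finset, Sym2.card,
      Nat.choose_two_right, Nat.add_sub_cancel, Nat.mul_comm (Fintype.card Q)]
  have hiff : ∀ as : List σ, as.foldl (auxF step) {s(p, q)} ∈ D.powerset ↔
      ∀ bs : List σ, bs.length = as.length →
        run step p (interleave as bs) = run step q (interleave as bs) := by
    intro as
    rw [Finset.mem_powerset]
    constructor
    · intro hs bs hl
      rw [← hmD]
      exact hs ((aux_mem step as _ _).2 ⟨s(p, q), by simp, bs, hl, rfl⟩)
    · intro hs z hz
      obtain ⟨y, hy, bs, hl, rfl⟩ := (aux_mem step as _ _).1 hz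
      rw [Finset.mem_singleton] at hy
      subst hy
      rw [Sym2.map_mk]
      exact (hmD _ _).2 (hs bs hl)
  obtain ⟨as, h⟩ := h
  obtain ⟨w, hw, hwP⟩ := aux_short (auxF step) D.powerset {s(p, q)}
    ⟨as, (hiff as).2 fun bs hl => h bs hl p q⟩
  exact ⟨w, hcard ▸ hw, (hiff w).1 hwP⟩
end

section
/- Alice has a winning strategy in the synchronization game on a DFA (Q,Σ) if and only if for every pair of states p,q ∈ Q she has a winning strategy to synchronize the subset {p,q}. -/
open MulOpposite

variable {Q σ : Type*}

/-- The word played after Alice's `k`-th move, when Alice follows the strategy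
`f` (prescribing her next letter as a function of the list of Bob's previous
responses) and Bob plays the letters `b 0, b 1, …`:
`a₁ b₁ a₂ b₂ ⋯ a_{k-1} b_{k-1} a_k` where `aᵢ = f [b 0, …, b (i-2)]`. -/
def playWord {σ : Type*} (f : List σ → σ) (b : ℕ → σ) : ℕ → List σ
  | 0 => []
  | k + 1 =>
      ((List.range k).flatMap fun i => [f ((List.range i).map b), b i]) ++
        [f ((List.range k).map b)]

/-- Alice has a winning strategy to synchronize the subset `S`: for some bound
`N` and strategy `f`, against every sequence `b` of Bob's responses, after some
`k ≤ N` of Alice's moves the image of `S` under the word played is a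
singleton. -/
def AliceWinsOn {Q σ : Type*} (step : Q → σ → Q) (S : Set Q) : Prop :=
  ∃ (N : ℕ) (f : List σ → σ), ∀ b : ℕ → σ, ∃ k ≤ N, ∃ q0 : Q,
    (fun q => run step q (playWord f b k)) '' S = {q0}

/-- Image of `S` under a word. -/
def imgW {Q σ : Type*} (step : Q → σ → Q) (S : Set Q) (w : List σ) : Set Q :=
  (fun q => run step q w) '' S

/-- Alice can force `P` after exactly `n` full rounds. -/
def VV {Q σ : Type*} (step : Q → σ → Q) (P : Set Q → Prop) : ℕ → Set Q → Prop
  | 0, S => P S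
  | n + 1, S => ∃ a, ∀ c, VV step P n (imgW step S [a, c])

def fullW {σ : Type*} (f : List σ → σ) (b : ℕ → σ) (n : ℕ) : List σ :=
  (List.range n).flatMap fun i => [f ((List.range i).map b), b i]

theorem fullW_succ' {σ : Type*} (f : List σ → σ) (b : ℕ → σ) (n : ℕ) :
    fullW f b (n+1) = [f [], b 0] ++ fullW (fun l => f (b 0 :: l)) (fun i => b (i+1)) n := by
  simp [fullW, List.range_succ_eq_map, List.flatMap_map, Function.comp_def]

theorem fullW_succ {σ : Type*} (f : List σ → σ) (b : ℕ → σ) (n : ℕ) :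
    fullW f b (n+1) = fullW f b n ++ [f ((List.range n).map b), b n] := by
  simp [fullW, List.range_succ]

theorem fullW_play {σ : Type*} (f : List σ → σ) (b : ℕ → σ) (n : ℕ) :
    playWord f b (n+1) = fullW f b n ++ [f ((List.range n).map b)] := rfl

theorem imgW_append {Q σ : Type*} (step : Q → σ → Q) (S : Set Q) (u v : List σ) :
    imgW step S (u ++ v) = imgW step (imgW step S u) v := by
  simp [imgW, run, Set.image_image]

theorem imgW_sub {Q σ : Type*} (step : Q → σ → Q) {S : Set Q} (h : S.Subsingleton) (v : List σ) :
    (imgW step S v).Subsingleton := h.image _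

theorem VV_of_strat {Q σ : Type*} (step : Q → σ → Q) (P : Set Q → Prop) (n : ℕ) :
    ∀ (S : Set Q) (f : List σ → σ), (∀ b, P (imgW step S (fullW f b n))) → VV step P n S := by
  induction n with
  | zero =>
    intro S f h
    simpa [imgW, run, fullW, VV] using h (fun _ => f [])
  | succ n ih =>
    intro S f h
    refine ⟨f [], fun c => ih _ (fun l => f (c :: l)) fun b => ?_⟩
    have := h (fun i => Nat.casesOn i c b)
    rw [fullW_succ', imgW_append] at this
    exact this

theorem strat_of_VV {Q σ : Type*} [Nonempty σ] (step : Q → σ → Q) (P : Set Q → Prop) (n : ℕ) :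
    ∀ (S : Set Q), VV step P n S →
      ∃ f : List σ → σ, ∀ b, P (imgW step S (fullW f b n)) := by
  induction n with
  | zero =>
    intro S h
    refine ⟨fun _ => Classical.arbitrary σ, fun b => ?_⟩
    simpa [imgW, run, fullW, VV] using h
  | succ n ih =>
    intro S h
    obtain ⟨a, h⟩ := h
    choose F hF using fun c => ih _ (h c)
    refine ⟨fun l => match l with
      | [] => a
      | c :: l => F c l, fun b => ?_⟩
    rw [fullW_succ', imgW_append]
    exact hF (b 0) _

theorem VV_trans {Q σ : Type*} (step : Q → σ → Q) (P R : Set Q → Prop) (m n : ℕ)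
    (hR : ∀ T, R T → VV step P m T) :
    ∀ S, VV step R n S → VV step P (m + n) S := by
  induction n with
  | zero => exact hR
  | succ n ih =>
    rintro S ⟨a, h⟩
    exact ⟨a, fun c => ih _ (h c)⟩

theorem VV_of_sub {Q σ : Type*} [Nonempty σ] (step : Q → σ → Q) (n : ℕ) :
    ∀ S : Set Q, S.Subsingleton → VV step Set.Subsingleton n S := by
  induction n with
  | zero => exact fun S h => h
  | succ n ih => exact fun S h => ⟨Classical.arbitrary σ, fun c => ih _ (imgW_sub step h _)⟩

theorem alice_iff {Q σ : Type*} [Nonempty σ] (step : Q → σ → Q) (S : Set Q) (hS : S.Nonempty) :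
    AliceWinsOn step S ↔ ∃ n, VV step Set.Subsingleton n S := by
  constructor
  · rintro ⟨N, f, h⟩
    refine ⟨N, VV_of_strat step _ N S f fun b => ?_⟩
    obtain ⟨k, hk, q0, hq⟩ := h b
    have h1 : (imgW step S (fullW f b k)).Subsingleton := by
      have h0 : (imgW step S (playWord f b k)).Subsingleton := by
        unfold imgW; rw [hq]; exact Set.subsingleton_singleton
      cases k with
      | zero => exact h0
      | succ k =>
        have : fullW f b (k+1) = playWord f b (k+1) ++ [b k] := by
          rw [fullW_succ, fullW_play]; simp
        rw [this, imgW_append]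
        exact imgW_sub step h0 _
    clear h
    induction N, hk using Nat.le_induction with
    | base => exact h1
    | succ m hm ih =>
      rw [fullW_succ, imgW_append]
      refine imgW_sub step ih _
  · rintro ⟨n, h⟩
    obtain ⟨f, hf⟩ := strat_of_VV step _ n S h
    refine ⟨n + 1, f, fun b => ⟨n + 1, le_rfl, ?_⟩⟩
    have h1 : (imgW step S (playWord f b (n+1))).Subsingleton := by
      rw [fullW_play, imgW_append]
      exact imgW_sub step (hf b) _
    exact Set.exists_eq_singleton_iff_nonempty_subsingleton.2 ⟨hS.image _, h1⟩

theorem VV_shrink {Q σ : Type*} [Finite Q] (step : Q → σ → Q) (k n : ℕ) :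
    ∀ (p q : Q) (S : Set Q), VV step Set.Subsingleton n {p, q} → p ∈ S → q ∈ S →
      S.ncard ≤ k + 2 → (p = q → S.ncard ≤ k + 1) →
      VV step (fun T => T.ncard ≤ k + 1) n S := by
  induction n with
  | zero =>
    intro p q S h _ _ _ h2
    exact h2 (h (by simp) (by simp))
  | succ n ih =>
    rintro p q S ⟨a, h⟩ hp hq h1 h2
    refine ⟨a, fun c => ?_⟩
    have hc := h c
    have e : imgW step {p, q} [a, c] = {run step p [a, c], run step q [a, c]} := by
      simp [imgW, Set.image_pair]
    rw [e] at hc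
    have hle : (imgW step S [a, c]).ncard ≤ S.ncard := Set.ncard_image_le S.toFinite
    refine ih _ _ _ hc ⟨p, hp, rfl⟩ ⟨q, hq, rfl⟩ (hle.trans h1) fun heq => ?_
    by_cases hpq : p = q
    · exact hle.trans (h2 hpq)
    · have : (imgW step S [a, c]).ncard ≠ S.ncard := fun hh =>
        hpq (Set.injOn_of_ncard_image_eq hh S.toFinite hp hq heq)
      omega

/-- Alice has a winning strategy in the synchronization game
on a DFA iff for every pair of states `p, q` she has a winning strategy to
synchronize `{p, q}`. -/
theorem alice_wins_iff_wins_on_pairs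
    {Q σ : Type*} [Finite Q] [Nonempty Q] [Finite σ]
    (step : Q → σ → Q) :
    AliceWinsOn step (Set.univ : Set Q) ↔
      ∀ p q : Q, AliceWinsOn step ({p, q} : Set Q) := by
  constructor
  · rintro ⟨N, f, h⟩ p q
    refine ⟨N, f, fun b => ?_⟩
    obtain ⟨k, hk, q0, hq⟩ := h b
    refine ⟨k, hk, q0, ?_⟩
    have hh : ∀ x, run step x (playWord f b k) = q0 := fun x => by
      have : run step x (playWord f b k) ∈ ({q0} : Set Q) := hq ▸ ⟨x, trivial, rfl⟩
      exact this
    simp [Set.image_pair, hh]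
  · intro h
    have : Nonempty σ := by
      obtain ⟨x⟩ := ‹Nonempty Q›
      obtain ⟨_, f, _⟩ := h x x
      exact ⟨f []⟩
    rw [alice_iff _ _ Set.univ_nonempty]
    have h' := fun p q : Q => (alice_iff step {p, q} (by simp)).1 (h p q)
    choose F hF using h'
    have key : ∀ k : ℕ, ∀ S : Set Q, S.ncard ≤ k + 1 →
        ∃ n, VV step Set.Subsingleton n S := by
      intro k
      induction k with
      | zero =>
        intro S hS
        exact ⟨0, (Set.ncard_le_one_iff_subsingleton).1 hS⟩
      | succ k ih =>
        intro S hS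
        by_cases hs : S.Subsingleton
        · exact ⟨0, hs⟩
        obtain ⟨p, hp, q, hq, hpq⟩ := Set.not_subsingleton_iff.1 hs
        choose! G hG using ih
        obtain ⟨M, hM⟩ := (Set.finite_range G).bddAbove
        refine ⟨M + F p q, VV_trans step _ (fun T => T.ncard ≤ k + 1) M _ ?_ S
          (VV_shrink step k _ p q S (hF p q) hp hq hS fun e => absurd e hpq)⟩
        intro T hT
        have hle : G T ≤ M := hM ⟨T, rfl⟩
        have := VV_trans step Set.Subsingleton Set.Subsingleton (M - G T) (G T)
          (VV_of_sub step _) T (hG T hT)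
        rwa [Nat.sub_add_cancel hle] at this
    exact key _ _ (Nat.le_succ _)
end
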